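/- Let A be a unital associative ℚ(q)-algebra and a, b, c, d ∈ A satisfying the defining relations of Manin's quantum 2×2 matrix algebra F_q[M_2]: ab = qba, ac = qca, bd = qdb, cd = qdc, bc = cb, ad − da = (q − q^{−1})bc. Set 𝐛 := (q − q^{−1})^{−1} b and 𝐜 := (q − q^{−1})^{−1} c, with 𝐛^{(j)} := 𝐛^j/[j]_q! and 𝐜^{(j)} := 𝐜^j/[j]_q!. Then for all n, m ∈ ℕ and r, s ∈ ℤ: C_q(a; r, n) C_q(d; s, m) − C_q(d; s, m) C_q(a; r, n) = Σ_{j=1}^{min(n,m)} q^{j((r+s)−(n+m)) + j(j−1)/2} (q − q^{−1})^j [j]_q! · {d; s | m, j} · 𝐜^{(j)} 𝐛^{(j)} · {a; r | n, j}. -/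

import Mathlib

open Finset

noncomputable section

/-- The base field `ℚ(q)` of rational functions over `ℚ`. -/
abbrev K : Type := RatFunc ℚ

/-- The indeterminate `q`. -/
def q : K := RatFunc.X

/-- The `x`-number `(n)_x = (x^n - 1)/(x - 1)`. -/
def qn (x : K) (n : ℕ) : K := (x ^ n - 1) / (x - 1)

/-- The `x`-factorial `(n)_x!`. -/
def qnFact (x : K) (n : ℕ) : K := ∏ r ∈ Finset.Icc 1 n, qn x r

/-- The `x`-binomial coefficient `binom_x(n,s)`, zero when `s > n`. -/
def qBinom (x : K) (n s : ℕ) : K :=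
  if s ≤ n then qnFact x n / (qnFact x s * qnFact x (n - s)) else 0

/-- The balanced `q`-integer `[n]_q = (q^n - q^{-n})/(q - q^{-1})`. -/
def qint (n : ℕ) : K := (q ^ n - q⁻¹ ^ n) / (q - q⁻¹)

/-- The balanced `q`-factorial `[n]_q!`. -/
def qintFact (n : ℕ) : K := ∏ r ∈ Finset.Icc 1 n, qint r

variable {A : Type*} [Ring A] [Algebra K A]

/-- The `q`-divided power `X^{(n)} = X^n / [n]_q!`. -/
def dp (X : A) (n : ℕ) : A := (qintFact n)⁻¹ • X ^ n

/-- The `q`-binomial coefficient `C_q(X; c, n) = ∏_{s=1}^n (q^{c+1-s} X - 1)/(q^s - 1)`. -/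
def Cq (X : A) (c : ℤ) : ℕ → A
  | 0 => 1
  | n + 1 => (q ^ ((n : ℤ) + 1) - 1)⁻¹ • (Cq X c n * (q ^ (c - (n : ℤ)) • X - 1))

/-- The bracket `{X; c | n, r} = Σ_{s=0}^r q^{s(s+1)/2} binom_q(r,s) C_q(X; c+s, n-r)`. -/
def Sq (X : A) (c : ℤ) (n r : ℕ) : A :=
  ∑ s ∈ Finset.range (r + 1),
    (q ^ (s * (s + 1) / 2) * qBinom q r s) • Cq X (c + (s : ℤ)) (n - r)

end

open Polynomial in
/-- The derivation-like operator `f ↦ (f(q²X) - f(X)) / X` on polynomials. -/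
noncomputable def qDiff : K[X] →ₗ[K] K[X] where
  toFun f := (f.comp (C (q ^ 2) * X) - f).divX
  map_add' f g := by
    ext n
    simp only [coeff_divX, coeff_sub, coeff_add, comp_C_mul_X_coeff]
    ring
  map_smul' x f := by
    ext n
    simp only [coeff_divX, coeff_sub, coeff_smul, comp_C_mul_X_coeff, smul_eq_mul,
      RingHom.id_apply]
    ring

/-- The unnormalised factorial `∏_{i=1}^n (x^i - 1)`. -/
noncomputable def pochFact (x : K) (n : ℕ) : K := ∏ i ∈ range n, (x ^ (i + 1) - 1)

theorem q_ne_zero : (q : K) ≠ 0 := RatFunc.X_ne_zero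

theorem q_pow_ne_one (n : ℕ) : (q : K) ^ (n + 1) ≠ 1 := by
  intro h
  have h2 : algebraMap (Polynomial ℚ) (RatFunc ℚ) (Polynomial.X ^ (n + 1)) =
      algebraMap (Polynomial ℚ) (RatFunc ℚ) 1 := by
    simpa [q, RatFunc.algebraMap_X] using h
  have h3 := congrArg Polynomial.natDegree (RatFunc.algebraMap_injective ℚ h2)
  simp at h3

theorem q_pow_sub_one_ne_zero (n : ℕ) : (q : K) ^ (n + 1) - 1 ≠ 0 :=
  sub_ne_zero.2 (q_pow_ne_one n)

theorem q_sub_one_ne_zero : (q : K) - 1 ≠ 0 := by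
  simpa using q_pow_sub_one_ne_zero 0

theorem q_sq_sub_one_ne_zero : (q : K) ^ 2 - 1 ≠ 0 := q_pow_sub_one_ne_zero 1

theorem q_sub_inv_ne_zero : (q : K) - q⁻¹ ≠ 0 := by
  have h1 := q_ne_zero
  have h : (q : K) - q⁻¹ = (q ^ 2 - 1) / q := by field_simp
  rw [h]
  exact div_ne_zero q_sq_sub_one_ne_zero h1

theorem pochFact_zero (x : K) : pochFact x 0 = 1 := by simp [pochFact]

theorem pochFact_succ (x : K) (n : ℕ) :
    pochFact x (n + 1) = pochFact x n * (x ^ (n + 1) - 1) := by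
  simp [pochFact, prod_range_succ]

theorem pochFact_q_ne_zero (n : ℕ) : pochFact q n ≠ 0 :=
  prod_ne_zero_iff.2 fun i _ => q_pow_sub_one_ne_zero i

theorem pochFact_q_sq_ne_zero (n : ℕ) : pochFact (q ^ 2) n ≠ 0 :=
  prod_ne_zero_iff.2 fun i _ => by
    rw [← pow_mul, show 2 * (i + 1) = (2 * i + 1) + 1 by ring]
    exact q_pow_sub_one_ne_zero _

theorem qnFact_eq_pochFact_div (n : ℕ) : qnFact q n = pochFact q n / (q - 1) ^ n := by
  induction n with
  | zero => simp [qnFact, pochFact]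
  | succ n ih =>
    rw [qnFact, prod_Icc_succ_top (by omega), ← qnFact, ih, pochFact_succ, qn,
      pow_succ (q - 1), div_mul_div_comm]

theorem qBinom_add (k l : ℕ) :
    qBinom q (k + l) k = pochFact q (k + l) / (pochFact q k * pochFact q l) := by
  have h := q_sub_one_ne_zero
  have h1 := pochFact_q_ne_zero k
  have h2 := pochFact_q_ne_zero l
  rw [qBinom, if_pos (by omega), Nat.add_sub_cancel_left, qnFact_eq_pochFact_div,
    qnFact_eq_pochFact_div, qnFact_eq_pochFact_div, pow_add]
  field_simp

theorem qBinom_eq_zero {n k : ℕ} (h : n < k) : qBinom q n k = 0 := by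
  rw [qBinom, if_neg (by omega)]

theorem qBinom_zero_right (n : ℕ) : qBinom q n 0 = 1 := by
  have h := qBinom_add 0 n
  rw [Nat.zero_add, pochFact_zero, one_mul, div_self (pochFact_q_ne_zero n)] at h
  exact h

theorem qBinom_self (n : ℕ) : qBinom q n n = 1 := by
  have h := qBinom_add n 0
  rw [Nat.add_zero, pochFact_zero, mul_one, div_self (pochFact_q_ne_zero n)] at h
  exact h

theorem qBinom_succ_succ (k l : ℕ) :
    qBinom q (k + l + 1) (k + 1) = qBinom q (k + l) (k + 1) + q ^ l * qBinom q (k + l) k := by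
  rcases l with _ | l
  · simp [qBinom_self, qBinom_eq_zero]
  · have h1 := pochFact_q_ne_zero k
    have h2 := pochFact_q_ne_zero l
    have h3 := q_pow_sub_one_ne_zero k
    have h4 := q_pow_sub_one_ne_zero l
    have e1 := qBinom_add (k + 1) (l + 1)
    have e2 := qBinom_add (k + 1) l
    have e3 := qBinom_add k (l + 1)
    rw [show k + 1 + (l + 1) = k + (l + 1) + 1 by ring] at e1
    rw [show k + 1 + l = k + (l + 1) by ring] at e2
    rw [e1, e2, e3, pochFact_succ q (k + (l + 1)), pochFact_succ q k, pochFact_succ q l]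
    field_simp
    ring

theorem sum_qBinom_mul_pow (j : ℕ) (y : K) :
    ∑ s ∈ range (j + 1), q ^ (s * (s + 1) / 2) * qBinom q j s * y ^ s =
      ∏ i ∈ range j, (1 + q ^ (i + 1) * y) := by
  induction j with
  | zero => simp [qBinom_self]
  | succ j ih =>
    have key : ∀ s ∈ range (j + 1),
        q ^ ((s + 1) * (s + 1 + 1) / 2) * qBinom q (j + 1) (s + 1) * y ^ (s + 1) =
          q ^ ((s + 1) * (s + 1 + 1) / 2) * qBinom q j (s + 1) * y ^ (s + 1) +
          q ^ (s * (s + 1) / 2) * qBinom q j s * y ^ s * (q ^ (j + 1) * y) := by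
      intro s hs
      obtain ⟨l, rfl⟩ := Nat.exists_eq_add_of_le (Nat.lt_succ_iff.1 (mem_range.1 hs))
      have ht : (s + 1) * (s + 1 + 1) / 2 = s * (s + 1) / 2 + (s + 1) := by
        have := Nat.triangle_succ (s + 1)
        simpa [mul_comm] using this
      rw [qBinom_succ_succ, ht, pow_add]
      ring
    rw [prod_range_succ, ← ih, sum_range_succ', sum_congr rfl key, sum_add_distrib, ← sum_mul,
      sum_range_succ (fun s => q ^ ((s + 1) * (s + 1 + 1) / 2) * qBinom q j (s + 1) * y ^ (s + 1)),
      qBinom_eq_zero (Nat.lt_succ_self j)]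
    have h0 := sum_range_succ' (fun s => q ^ (s * (s + 1) / 2) * qBinom q j s * y ^ s) j
    simp only [qBinom_zero_right] at h0 ⊢
    linear_combination -h0

section PolynomialModel

open Polynomial

theorem coeff_qDiff (f : K[X]) (n : ℕ) :
    (qDiff f).coeff n = ((q ^ 2) ^ (n + 1) - 1) * f.coeff (n + 1) := by
  simp only [qDiff, LinearMap.coe_mk, AddHom.coe_mk, coeff_divX, coeff_sub, comp_C_mul_X_coeff]
  ring

theorem coeff_qDiff_pow (j : ℕ) (f : K[X]) (n : ℕ) :
    ((qDiff ^ j) f).coeff n =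
      (∏ i ∈ range j, ((q ^ 2) ^ (n + i + 1) - 1)) * f.coeff (n + j) := by
  induction j generalizing n with
  | zero => simp
  | succ j ih =>
    rw [pow_succ', Module.End.mul_apply, coeff_qDiff, ih, prod_range_succ']
    simp only [add_zero, show ∀ i, n + (i + 1) + 1 = n + 1 + i + 1 from fun i => by ring,
      show n + (j + 1) = n + 1 + j by ring]
    ring

theorem qDiff_X_mul (f : K[X]) :
    qDiff (X * f) = (q ^ 2) • (X * qDiff f) + (q ^ 2 - 1) • f := by
  ext n
  rw [coeff_qDiff, coeff_X_mul]
  rcases n with _ | n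
  · simp
  · simp only [coeff_add, coeff_smul, coeff_X_mul, coeff_qDiff, smul_eq_mul]
    ring

theorem qDiff_pow_X_mul (j : ℕ) (f : K[X]) :
    (qDiff ^ (j + 1)) (X * f) = ((q ^ 2) ^ (j + 1)) • (X * (qDiff ^ (j + 1)) f) +
      ((q ^ 2) ^ (j + 1) - 1) • (qDiff ^ j) f := by
  ext n
  simp only [coeff_add, coeff_smul, coeff_qDiff_pow, smul_eq_mul,
    show n + (j + 1) = n + j + 1 by ring, coeff_X_mul]
  rcases n with _ | n
  · simp only [mul_coeff_zero, coeff_X_zero, prod_range_succ]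
    simp only [zero_add]
    ring
  · simp only [coeff_X_mul, coeff_qDiff_pow]
    rw [prod_range_succ, prod_range_succ']
    simp only [show ∀ i, n + (i + 1) + 1 = n + 1 + i + 1 from fun i => by ring,
      show n + 1 + j = n + j + 1 by ring]
    ring_nf

theorem qDiff_pow_eq_zero {j : ℕ} {f : K[X]} (h : f.natDegree < j) : (qDiff ^ j) f = 0 := by
  ext n
  rw [coeff_qDiff_pow, coeff_eq_zero_of_natDegree_lt (by omega), mul_zero, coeff_zero]

theorem natDegree_Cq_X_le (c : ℤ) (n : ℕ) : (Cq (X : K[X]) c n).natDegree ≤ n := by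
  induction n with
  | zero => simp [Cq]
  | succ n ih =>
    rw [Cq]
    refine (natDegree_smul_le _ _).trans (natDegree_mul_le.trans (Nat.add_le_add ih ?_))
    refine (natDegree_sub_le _ _).trans (max_le ((natDegree_smul_le _ _).trans natDegree_X_le) ?_)
    simp

theorem coeff_Cq_X (c : ℤ) (k l : ℕ) :
    (Cq (X : K[X]) c (k + l)).coeff k =
      (-1) ^ l * q ^ (((k * (k - 1) / 2 : ℕ) : ℤ) + (c + 1 - (k + l : ℕ)) * k) /
        (pochFact q k * pochFact q l) := by
  have hq := q_ne_zero
  induction hn : k + l generalizing k l with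
  | zero =>
    obtain ⟨rfl, rfl⟩ : k = 0 ∧ l = 0 := by omega
    simp [Cq, pochFact_zero]
  | succ n ih =>
    have hP : (q : K) ^ ((n : ℤ) + 1) - 1 ≠ 0 := by
      exact_mod_cast q_pow_sub_one_ne_zero n
    rw [Cq, coeff_smul, smul_eq_mul, mul_sub, coeff_sub, mul_one, mul_smul_comm, coeff_smul,
      smul_eq_mul, inv_mul_eq_iff_eq_mul₀ hP]
    rcases k with _ | k
    · obtain rfl : l = n + 1 := by omega
      have h := ih 0 n (by omega)
      have h2 := pochFact_q_ne_zero n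
      have h4 : (q : K) ^ (n + 1) - 1 ≠ 0 := q_pow_sub_one_ne_zero n
      rw [h, mul_coeff_zero, coeff_X_zero, pochFact_succ, pochFact_zero]
      rw [show ((q : K) ^ ((n : ℤ) + 1)) = q ^ (n + 1) by exact_mod_cast rfl]
      simp
      field_simp
      ring
    · have ht := Nat.triangle_succ k
      rw [coeff_mul_X, ih k l (by omega), ht]
      have h1 := pochFact_q_ne_zero k
      have h2 := pochFact_q_ne_zero l
      have h3 := q_pow_sub_one_ne_zero k
      generalize k * (k - 1) / 2 = t at *
      have e1 : q ^ (c - n) * q ^ ((t : ℤ) + (c + 1 - n) * k) =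
          q ^ (((t + k : ℕ) : ℤ) + (c + 1 - (n + 1 : ℕ)) * (k + 1 : ℕ)) := by
        rw [← zpow_add₀ hq]
        congr 1
        push_cast
        ring
      rcases l with _ | l
      · rw [coeff_eq_zero_of_natDegree_lt ((natDegree_Cq_X_le c n).trans_lt (by omega)), sub_zero,
          mul_div_assoc', mul_left_comm, e1, pochFact_succ]
        obtain rfl : k = n := by omega
        rw [show ((q : K) ^ ((k : ℤ) + 1)) = q ^ (k + 1) by exact_mod_cast rfl]
        field_simp
      · have h5 := pochFact_q_ne_zero l
        have h4 := q_pow_sub_one_ne_zero l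
        have e2 : q ^ (((t + k : ℕ) : ℤ) + (c + 1 - (n : ℤ)) * (k + 1 : ℕ)) =
            q ^ (k + 1) *
            q ^ (((t + k : ℕ) : ℤ) + (c + 1 - (n + 1 : ℕ)) * (k + 1 : ℕ)) := by
          rw [← zpow_natCast q (k + 1), ← zpow_add₀ hq]
          congr 1
          push_cast
          ring
        rw [ih (k + 1) l (by omega), ht, e2, mul_div_assoc', mul_left_comm, e1, pochFact_succ q k,
          pochFact_succ q l]
        obtain rfl : n = k + l + 1 := by omega
        rw [show ((q : K) ^ (((k + l + 1 : ℕ) : ℤ) + 1)) = q ^ (k + l + 1 + 1) by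
          exact_mod_cast rfl]
        generalize q ^ (((t + k : ℕ) : ℤ) + (c + 1 - (k + l + 1 + 1 : ℕ)) *
          (k + 1 : ℕ)) = z
        field_simp
        ring

theorem coeff_Sq_X (c : ℤ) (k l j : ℕ) :
    (Sq (X : K[X]) c (k + l + j) j).coeff k =
      (∏ i ∈ range j, (1 + q ^ (i + 1) * q ^ k)) *
        (Cq (X : K[X]) c (k + l)).coeff k := by
  have hq := q_ne_zero
  rw [Sq, finsetSum_coeff, ← sum_qBinom_mul_pow, sum_mul]
  refine sum_congr rfl fun s _ => ?_
  rw [coeff_smul, smul_eq_mul, Nat.add_sub_cancel, coeff_Cq_X, coeff_Cq_X,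
    show ((k * (k - 1) / 2 : ℕ) : ℤ) + (c + s + 1 - (k + l : ℕ)) * k =
      (((k * (k - 1) / 2 : ℕ) : ℤ) + (c + 1 - (k + l : ℕ)) * k) + ((k * s : ℕ) : ℤ) by
      push_cast; ring, zpow_add₀ hq, zpow_natCast, pow_mul]
  ring

theorem triangle_add (k j : ℕ) :
    (k + j) * (k + j - 1) / 2 = k * (k - 1) / 2 + j * (j - 1) / 2 + k * j := by
  induction j with
  | zero => simp
  | succ j ih =>
    rw [← add_assoc, Nat.triangle_succ, Nat.triangle_succ, ih]
    ring

theorem qDiff_pow_Cq_X (c : ℤ) {n j : ℕ} (hj : j ≤ n) :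
    (qDiff ^ j) (Cq (X : K[X]) c n) =
      (q ^ (((j * (j - 1) / 2 : ℕ) : ℤ) + (c + 1 - n) * j)) • Sq (X : K[X]) c n j := by
  have hq := q_ne_zero
  ext k
  rw [coeff_qDiff_pow, coeff_smul, smul_eq_mul]
  by_cases hk : k + j ≤ n
  · obtain ⟨l, rfl⟩ := Nat.exists_eq_add_of_le hk
    rw [coeff_Cq_X, show k + j + l = k + l + j by ring, coeff_Sq_X, coeff_Cq_X, triangle_add]
    have h1 := pochFact_q_ne_zero k
    have h2 := pochFact_q_ne_zero l
    have h3 : ∏ i ∈ range j, ((q : K) ^ (k + i + 1) - 1) ≠ 0 :=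
      prod_ne_zero_iff.2 fun i _ => q_pow_sub_one_ne_zero _
    have e1 : pochFact q (k + j) =
        pochFact q k * ∏ i ∈ range j, ((q : K) ^ (k + i + 1) - 1) := by
      rw [pochFact, prod_range_add, pochFact]
    have e2 : ∏ i ∈ range j, (((q : K) ^ 2) ^ (k + i + 1) - 1) =
        (∏ i ∈ range j, ((q : K) ^ (k + i + 1) - 1)) *
          ∏ i ∈ range j, (1 + q ^ (i + 1) * q ^ k) := by
      rw [← prod_mul_distrib]
      refine prod_congr rfl fun i _ => ?_
      ring
    have e3 : q ^ (((k * (k - 1) / 2 + j * (j - 1) / 2 + k * j : ℕ) : ℤ) +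
        (c + 1 - (k + l + j : ℕ)) * (k + j : ℕ)) =
        q ^ (((j * (j - 1) / 2 : ℕ) : ℤ) + (c + 1 - (k + l + j : ℕ)) * j) *
        q ^ (((k * (k - 1) / 2 : ℕ) : ℤ) + (c + 1 - (k + l : ℕ)) * k) := by
      rw [← zpow_add₀ hq]
      congr 1
      push_cast
      ring
    rw [e1, e2, e3]
    generalize ∏ i ∈ range j, (1 + q ^ (i + 1) * q ^ k) = w
    field_simp
  · rw [coeff_eq_zero_of_natDegree_lt ((natDegree_Cq_X_le c n).trans_lt (by omega)), mul_zero,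
      Sq, finsetSum_coeff, sum_eq_zero, mul_zero]
    intro s _
    rw [coeff_smul, coeff_eq_zero_of_natDegree_lt
      ((natDegree_Cq_X_le _ _).trans_lt (by omega)), smul_zero]

theorem aeval_Cq_X {A : Type*} [Ring A] [Algebra K A] (x : A) (c : ℤ) (n : ℕ) :
    aeval x (Cq (X : K[X]) c n) = Cq x c n := by
  induction n with
  | zero => simp [Cq]
  | succ n ih => simp only [Cq, map_smul, map_mul, map_sub, map_one, aeval_X, ih]

theorem aeval_Sq_X {A : Type*} [Ring A] [Algebra K A] (x : A) (c : ℤ) (n r : ℕ) :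
    aeval x (Sq (X : K[X]) c n r) = Sq x c n r := by
  simp only [Sq, map_sum, map_smul, aeval_Cq_X]

end PolynomialModel

section Straightening

open Polynomial

variable {A : Type*} [Ring A] [Algebra K A] {a d e : A}

theorem mul_pow_of_q_commute (hae : a * e = (q ^ 2 : K) • (e * a)) (j : ℕ) :
    a * e ^ j = ((q ^ 2) ^ j : K) • (e ^ j * a) := by
  induction j with
  | zero => simp
  | succ j ih =>
    rw [pow_succ e, ← mul_assoc, ih, smul_mul_assoc, mul_assoc, hae, mul_smul_comm, smul_smul,
      ← mul_assoc, pow_succ (q ^ 2 : K)]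

theorem mul_aeval_of_commutator (hed : e * d = (q ^ 2 : K) • (d * e))
    (had : a * d - d * a = (q - q⁻¹ : K) • e) (g : K[X]) :
    a * aeval d g = aeval d g * a + (q⁻¹ : K) • (aeval d (qDiff g) * e) := by
  have hq := q_ne_zero
  induction g using Polynomial.induction_on' with
  | add f g hf hg =>
    simp only [map_add, mul_add, add_mul, smul_add, hf, hg]
    abel
  | monomial n x =>
    rw [← C_mul_X_pow_eq_monomial, ← smul_eq_C_mul]
    simp only [map_smul, mul_smul_comm, smul_mul_assoc]
    rw [smul_comm (q⁻¹ : K) x, ← smul_add]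
    congr 1
    have hX : ∀ n : ℕ, e * d ^ n = ((q ^ 2) ^ n : K) • (d ^ n * e) := by
      intro n
      induction n with
      | zero => simp
      | succ n ih =>
        rw [pow_succ, ← mul_assoc, ih, smul_mul_assoc, mul_assoc, hed, mul_smul_comm, smul_smul,
          ← mul_assoc, pow_succ (q ^ 2 : K)]
    have hD : ∀ n : ℕ, qDiff (X ^ (n + 1) : K[X]) = ((q ^ 2) ^ (n + 1) - 1 : K) • X ^ n := by
      intro n
      ext k
      simp only [coeff_qDiff, coeff_smul, coeff_X_pow, smul_eq_mul, add_left_inj]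
      split_ifs with h
      · rw [h]
      · simp
    have had' : a * d = d * a + (q - q⁻¹ : K) • e := by rw [← had]; abel
    induction n with
    | zero =>
      have : qDiff (1 : K[X]) = 0 := by
        ext k
        rw [coeff_qDiff, coeff_one, if_neg (by omega), mul_zero, coeff_zero]
      simp [this]
    | succ n ih =>
      rw [pow_succ' X n, map_mul, aeval_X, ← mul_assoc, had', add_mul, mul_assoc, ih, mul_add,
        smul_mul_assoc, map_pow, aeval_X, hX, ← pow_succ' X n, hD]
      simp only [map_smul, map_pow, aeval_X]
      rcases n with _ | n
      · have : qDiff (1 : K[X]) = 0 := by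
          ext k
          rw [coeff_qDiff, coeff_one, if_neg (by omega), mul_zero, coeff_zero]
        simp only [pow_zero, this, map_zero, zero_mul, smul_zero, mul_zero, add_zero, mul_one,
          one_mul, one_smul, smul_smul, smul_mul_assoc]
        congr 2
        field_simp
        ring
      · rw [hD]
        simp only [map_smul, map_pow, aeval_X, smul_mul_assoc, mul_smul_comm, smul_smul,
          ← mul_assoc, ← pow_succ']
        rw [add_assoc, ← add_smul]
        congr 2
        field_simp
        ring

theorem aeval_X_pow_mul_aeval (hae : a * e = (q ^ 2 : K) • (e * a))
    (hed : e * d = (q ^ 2 : K) • (d * e)) (had : a * d - d * a = (q - q⁻¹ : K) • e)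
    (g : K[X]) (N k : ℕ) (hk : k ≤ N) :
    aeval a (X ^ k : K[X]) * aeval d g =
      ∑ j ∈ range (N + 1), ((q⁻¹) ^ j / pochFact (q ^ 2) j : K) •
        (aeval d ((qDiff ^ j) g) * e ^ j * aeval a ((qDiff ^ j) (X ^ k : K[X]))) := by
  have hq := q_ne_zero
  induction k with
  | zero =>
    rw [sum_range_succ', sum_eq_zero]
    · simp [pochFact_zero]
    · intro j _
      rw [qDiff_pow_eq_zero (f := X ^ 0) (by simp), map_zero, mul_zero, smul_zero]
  | succ k ih =>
    rw [pow_succ' X k, map_mul, aeval_X, mul_assoc, ih (by omega), mul_sum]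
    have hstep : ∀ j, a * ((q⁻¹) ^ j / pochFact (q ^ 2) j : K) •
        (aeval d ((qDiff ^ j) g) * e ^ j * aeval a ((qDiff ^ j) (X ^ k : K[X]))) =
        ((q⁻¹) ^ j / pochFact (q ^ 2) j * (q ^ 2) ^ j : K) •
          (aeval d ((qDiff ^ j) g) * e ^ j * aeval a (X * (qDiff ^ j) (X ^ k : K[X]))) +
        ((q⁻¹) ^ (j + 1) / pochFact (q ^ 2) j : K) •
          (aeval d ((qDiff ^ (j + 1)) g) * e ^ (j + 1) *
            aeval a ((qDiff ^ j) (X ^ k : K[X]))) := by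
      intro j
      rw [mul_smul_comm, ← mul_assoc, ← mul_assoc, mul_aeval_of_commutator hed had, add_mul,
        add_mul, mul_assoc _ a, mul_pow_of_q_commute hae, pow_succ' qDiff, Module.End.mul_apply,
        pow_succ' e, map_mul, aeval_X]
      simp only [smul_add, smul_mul_assoc, mul_smul_comm, smul_smul, mul_assoc]
      congr 2
      ring
    have hstep' : ∀ j, ((q⁻¹) ^ (j + 1) / pochFact (q ^ 2) (j + 1) : K) •
        (aeval d ((qDiff ^ (j + 1)) g) * e ^ (j + 1) *
          aeval a ((qDiff ^ (j + 1)) (X * X ^ k : K[X]))) =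
        ((q⁻¹) ^ (j + 1) / pochFact (q ^ 2) (j + 1) * (q ^ 2) ^ (j + 1) : K) •
          (aeval d ((qDiff ^ (j + 1)) g) * e ^ (j + 1) *
            aeval a (X * (qDiff ^ (j + 1)) (X ^ k : K[X]))) +
        ((q⁻¹) ^ (j + 1) / pochFact (q ^ 2) j : K) •
          (aeval d ((qDiff ^ (j + 1)) g) * e ^ (j + 1) *
            aeval a ((qDiff ^ j) (X ^ k : K[X]))) := by
      intro j
      have h1 := pochFact_q_sq_ne_zero (j + 1)
      rw [pochFact_succ] at h1
      have h2 := left_ne_zero_of_mul h1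
      have h3 := right_ne_zero_of_mul h1
      rw [qDiff_pow_X_mul, map_add, map_smul, map_smul, mul_add, smul_add, mul_smul_comm,
        mul_smul_comm, smul_smul, smul_smul, pochFact_succ]
      congr 2
      field_simp
    rw [sum_congr rfl fun j _ => hstep j, sum_add_distrib, sum_range_succ' _ N,
      sum_range_succ _ N, qDiff_pow_eq_zero (f := X ^ k) (j := N) (by simp; omega),
      sum_range_succ' _ N, sum_congr rfl fun j _ => hstep' j, sum_add_distrib]
    simp only [map_zero, mul_zero, smul_zero, add_zero, pow_zero, mul_one, Module.End.one_apply]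
    abel

theorem aeval_mul_aeval (hae : a * e = (q ^ 2 : K) • (e * a))
    (hed : e * d = (q ^ 2 : K) • (d * e)) (had : a * d - d * a = (q - q⁻¹ : K) • e)
    (g : K[X]) (N : ℕ) (f : K[X]) (hf : f.natDegree ≤ N) :
    aeval a f * aeval d g =
      ∑ j ∈ range (N + 1), ((q⁻¹) ^ j / pochFact (q ^ 2) j : K) •
        (aeval d ((qDiff ^ j) g) * e ^ j * aeval a ((qDiff ^ j) f)) := by
  refine induction_with_natDegree_le (fun f => aeval a f * aeval d g =
    ∑ j ∈ range (N + 1), ((q⁻¹) ^ j / pochFact (q ^ 2) j : K) •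
      (aeval d ((qDiff ^ j) g) * e ^ j * aeval a ((qDiff ^ j) f))) N ?_ ?_ ?_ f hf
  · simp
  · intro k x _ hk
    rw [← smul_eq_C_mul]
    simp only [map_smul, smul_mul_assoc, mul_smul_comm]
    rw [aeval_X_pow_mul_aeval hae hed had g N k hk, smul_sum]
    exact sum_congr rfl fun j _ => smul_comm _ _ _
  · intro f h _ _ ihf ihh
    simp only [map_add, add_mul, mul_add, smul_add, sum_add_distrib]
    rw [ihf, ihh]

end Straightening

theorem q_sub_inv_pow_mul_qintFact (j : ℕ) :
    (q - q⁻¹) ^ j * qintFact j * q ^ (j * (j - 1) / 2 + j) = pochFact (q ^ 2) j := by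
  have hq := q_ne_zero
  induction j with
  | zero => simp [qintFact, pochFact_zero]
  | succ j ih =>
    have h := q_sub_inv_ne_zero
    rw [qintFact, prod_Icc_succ_top (by omega), ← qintFact, pochFact_succ, ← ih,
      Nat.triangle_succ, qint, pow_succ, pow_add _ _ (j + 1)]
    have : (q ^ (j + 1) - q⁻¹ ^ (j + 1)) * q ^ (j + 1) = (q ^ 2) ^ (j + 1) - 1 := by
      rw [sub_mul, ← mul_pow q⁻¹, inv_mul_cancel₀ hq, one_pow]
      ring
    rw [← this, mul_div_assoc']
    generalize (q : K) - q⁻¹ = u at h ⊢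
    field_simp

theorem qintFact_ne_zero (j : ℕ) : qintFact j ≠ 0 := by
  intro h
  apply pochFact_q_sq_ne_zero j
  rw [← q_sub_inv_pow_mul_qintFact, h, mul_zero, zero_mul]

theorem statement13 {A : Type*} [Ring A] [Algebra K A] (a b c d : A)
    (hab : a * b = (q : K) • (b * a)) (hac : a * c = (q : K) • (c * a))
    (hbd : b * d = (q : K) • (d * b)) (hcd : c * d = (q : K) • (d * c))
    (hbc : b * c = c * b)
    (hcomm : a * d - d * a = ((q - q⁻¹ : K)) • (b * c))
    (n m : ℕ) (r s : ℤ) :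
    Cq a r n * Cq d s m - Cq d s m * Cq a r n =
      ∑ j ∈ Finset.Icc 1 (min n m),
        (q ^ ((j : ℤ) * ((r + s) - ((n : ℤ) + m)) + ((j * (j - 1) / 2 : ℕ) : ℤ)) *
            (q - q⁻¹) ^ j * qintFact j) •
          (Sq d s m j * (dp ((q - q⁻¹ : K)⁻¹ • c) j * dp ((q - q⁻¹ : K)⁻¹ • b) j) *
            Sq a r n j) := by
  have hq := q_ne_zero
  have hae : a * (b * c) = (q ^ 2 : K) • (b * c * a) := by
    rw [← mul_assoc, hab, smul_mul_assoc, mul_assoc, hac, mul_smul_comm, smul_smul, mul_assoc,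
      pow_two]
  have hed : b * c * d = (q ^ 2 : K) • (d * (b * c)) := by
    rw [mul_assoc, hcd, mul_smul_comm, ← mul_assoc, hbd, smul_mul_assoc, smul_smul, mul_assoc,
      pow_two]
  have hmain := aeval_mul_aeval hae hed hcomm (Cq Polynomial.X s m) n (Cq Polynomial.X r n)
    (natDegree_Cq_X_le r n)
  rw [aeval_Cq_X, aeval_Cq_X, sum_range_succ'] at hmain
  rw [hmain]
  simp only [pow_zero, Module.End.one_apply, pochFact_zero, div_one, one_smul, mul_one,
    aeval_Cq_X, add_sub_cancel_right]
  rw [range_eq_Ico, sum_Ico_add' (fun j => ((q⁻¹) ^ j / pochFact (q ^ 2) j : K) •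
        (Polynomial.aeval d ((qDiff ^ j) (Cq Polynomial.X s m)) * (b * c) ^ j *
          Polynomial.aeval a ((qDiff ^ j) (Cq Polynomial.X r n)))) 0 n 1]
  symm
  refine sum_subset_zero_on_sdiff (fun j hj => ?_) (fun j hj => ?_) (fun j hj => ?_)
  · simp only [mem_Icc, mem_Ico, le_min_iff] at hj ⊢
    omega
  · simp only [mem_sdiff, mem_Icc, mem_Ico, le_min_iff] at hj
    rw [qDiff_pow_eq_zero ((natDegree_Cq_X_le s m).trans_lt (by omega)), map_zero, zero_mul,
      zero_mul, smul_zero]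
  · simp only [mem_Icc, le_min_iff] at hj
    rw [qDiff_pow_Cq_X s hj.2.2, qDiff_pow_Cq_X r hj.2.1, map_smul, map_smul, aeval_Sq_X,
      aeval_Sq_X, hbc, (show Commute c b from hbc.symm).mul_pow, dp, dp, smul_pow, smul_pow]
    simp only [smul_mul_assoc, mul_smul_comm, smul_smul, mul_assoc]
    congr 1
    have h1 := qintFact_ne_zero j
    have h2 : (q - q⁻¹ : K) ^ j ≠ 0 := pow_ne_zero _ q_sub_inv_ne_zero
    have e1 : q ^ (((j * (j - 1) / 2 : ℕ) : ℤ) + (r + 1 - n) * j) *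
        q ^ (((j * (j - 1) / 2 : ℕ) : ℤ) + (s + 1 - m) * j) =
        q ^ ((j : ℤ) * ((r + s) - ((n : ℤ) + m)) + ((j * (j - 1) / 2 : ℕ) : ℤ)) *
          q ^ (j * (j - 1) / 2 + j) * q ^ j := by
      rw [← zpow_natCast q j, ← zpow_natCast q (j * (j - 1) / 2 + j), ← zpow_add₀ hq,
        ← zpow_add₀ hq, ← zpow_add₀ hq]
      congr 1
      push_cast
      ring
    rw [← q_sub_inv_pow_mul_qintFact, mul_right_comm, mul_assoc, e1, inv_pow, inv_pow]
    generalize q ^ ((j : ℤ) * ((r + s) - ((n : ℤ) + m)) + ((j * (j - 1) / 2 : ℕ) : ℤ)) = z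
    generalize (q - q⁻¹ : K) ^ j = w at h2 ⊢
    field_simp
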